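/- Let X be a proper metric space (closed bounded subsets are compact), let (fₙ) be a sequence of surjective isometries of X (isometric bijections X → X), let x₀ ∈ X and C ∈ ℝ be such that dist(fₙ(x₀), x₀) ≤ C for all n. Then there exist a strictly increasing function φ : ℕ → ℕ and a surjective isometry g of X such that for every x ∈ X, fₙ₍φ₎(x) → g(x) as n → ∞, and fₙ₍φ₎⁻¹(x) → g⁻¹(x) as n → ∞. -/

import Mathlib

open Filter Topology

open scoped NNReal

/-- A sequence of `K`-Lipschitz maps from a separable space to a proper space which is bounded
at one point has a subsequence converging pointwise. -/
theorem LipschitzWith.exists_subseq_tendsto_pointwise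
    {X Y : Type*} [PseudoMetricSpace X] [TopologicalSpace.SeparableSpace X]
    [PseudoMetricSpace Y] [ProperSpace Y]
    {K : ℝ≥0} {F : ℕ → X → Y} (hF : ∀ n, LipschitzWith K (F n)) (x₀ : X) (y₀ : Y) (C : ℝ)
    (hC : ∀ n, dist (F n x₀) y₀ ≤ C) :
    ∃ φ : ℕ → ℕ, StrictMono φ ∧
      ∃ g : X → Y, ∀ x, Tendsto (fun n => F (φ n) x) atTop (𝓝 (g x)) := by
  have : Nonempty X := ⟨x₀⟩
  let d := TopologicalSpace.denseSeq X
  have hcpt : IsCompact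
      (Set.univ.pi fun k => Metric.closedBall y₀ (K * dist (d k) x₀ + C)) :=
    isCompact_univ_pi fun k => isCompact_closedBall _ _
  obtain ⟨a, -, φ, hφ, ha⟩ := hcpt.tendsto_subseq (x := fun n k => F n (d k)) fun n k _ =>
    (dist_triangle _ (F n x₀) _).trans (add_le_add ((hF n).dist_le_mul _ _) (hC n))
  rw [tendsto_pi_nhds] at ha
  have hcauchy : ∀ x, CauchySeq fun n => F (φ n) x := by
    intro x
    refine Metric.cauchySeq_iff.2 fun ε hε => ?_
    have hK : 0 < (K : ℝ) + 1 := by positivity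
    obtain ⟨k, hk⟩ := (TopologicalSpace.denseRange_denseSeq X).exists_dist_lt x
      (show 0 < ε / 3 / (K + 1) by positivity)
    obtain ⟨N, hN⟩ := Metric.cauchySeq_iff.1 (ha k).cauchySeq (ε / 3) (by positivity)
    refine ⟨N, fun m hm n hn => ?_⟩
    have hmn : dist (F (φ m) (d k)) (F (φ n) (d k)) < ε / 3 := hN m hm n hn
    have hle : ∀ i, dist (F i x) (F i (d k)) ≤ ε / 3 := fun i => by
      rw [lt_div_iff₀ hK] at hk
      have := (hF i).dist_le_mul x (d k)
      have : 0 ≤ dist x (d k) := dist_nonneg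
      change dist x (d k) * (K + 1) < _ at hk
      linarith
    have := dist_triangle4 (F (φ m) x) (F (φ m) (d k)) (F (φ n) (d k)) (F (φ n) x)
    have := hle (φ m)
    have := hle (φ n)
    rw [dist_comm] at this
    linarith
  choose g hg using fun x => cauchySeq_tendsto_of_complete (hcauchy x)
  exact ⟨φ, hφ, g, hg⟩

/-- A pointwise limit of isometries is an isometry. -/
theorem Isometry.of_tendsto_pointwise {ι X Y : Type*} [PseudoMetricSpace X]
    [PseudoMetricSpace Y] {l : Filter ι} [l.NeBot] {F : ι → X → Y} {g : X → Y}
    (hF : ∀ i, Isometry (F i)) (hg : ∀ x, Tendsto (fun i => F i x) l (𝓝 (g x))) :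
    Isometry g :=
  Isometry.of_dist_eq fun x y => tendsto_nhds_unique ((hg x).dist (hg y)) <| by
    simp only [(hF _).dist_eq, tendsto_const_nhds]

/-- If isometries `F i` converge pointwise to `g` and right inverses `G i` of the `F i` converge
at `y` to `z`, then `g z = y`. -/
theorem Isometry.apply_eq_of_tendsto {ι X Y : Type*} [PseudoMetricSpace X]
    [MetricSpace Y] {l : Filter ι} [l.NeBot] {F : ι → X → Y} {g : X → Y} {G : ι → Y → X}
    {y : Y} {z : X} (hF : ∀ i, Isometry (F i)) (hFG : ∀ i, F i (G i y) = y)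
    (hg : Tendsto (fun i => F i z) l (𝓝 (g z))) (hz : Tendsto (fun i => G i y) l (𝓝 z)) :
    g z = y := by
  refine tendsto_nhds_unique hg (tendsto_iff_dist_tendsto_zero.2 ?_)
  refine (tendsto_iff_dist_tendsto_zero.1 hz).congr fun i => ?_
  rw [← (hF i).dist_eq, hFG, dist_comm]

/-- Ascoli–Arzelà for isometries: a sequence of surjective isometries of a
proper metric space with uniformly bounded displacement at a point admits a
subsequence converging pointwise, together with the inverses, to a surjective
isometry and its inverse. -/
theorem exists_subseq_tendsto_isometryEquiv
    {X : Type*} [MetricSpace X] [ProperSpace X]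
    (f : ℕ → X ≃ᵢ X) (x₀ : X) (C : ℝ)
    (hC : ∀ n : ℕ, dist (f n x₀) x₀ ≤ C) :
    ∃ φ : ℕ → ℕ, StrictMono φ ∧ ∃ g : X ≃ᵢ X,
      (∀ x : X, Tendsto (fun n => f (φ n) x) atTop (𝓝 (g x))) ∧
      (∀ x : X, Tendsto (fun n => (f (φ n)).symm x) atTop (𝓝 (g.symm x))) := by
  obtain ⟨φ, hφ, g, hg⟩ := LipschitzWith.exists_subseq_tendsto_pointwise
    (fun n => (f n).isometry.lipschitz) x₀ x₀ C hC
  obtain ⟨ψ, hψ, h, hh⟩ := LipschitzWith.exists_subseq_tendsto_pointwise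
    (fun n => (f (φ n)).symm.isometry.lipschitz) x₀ x₀ C fun n => by
      rw [← (f (φ n)).dist_eq, IsometryEquiv.apply_symm_apply, dist_comm]
      exact hC _
  have hgψ : ∀ x, Tendsto (fun n => f (φ (ψ n)) x) atTop (𝓝 (g x)) :=
    fun x => (hg x).comp hψ.tendsto_atTop
  refine ⟨φ ∘ ψ, hφ.comp hψ, ⟨⟨g, h, fun x => ?_, fun y => ?_⟩, ?_⟩, hgψ, hh⟩
  · exact Isometry.apply_eq_of_tendsto (G := fun n => f (φ (ψ n)))
      (fun n => (f (φ (ψ n))).symm.isometry)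
      (fun n => (f (φ (ψ n))).symm_apply_apply x) (hh _) (hgψ x)
  · exact Isometry.apply_eq_of_tendsto (G := fun n => (f (φ (ψ n))).symm)
      (fun n => (f (φ (ψ n))).isometry)
      (fun n => (f (φ (ψ n))).apply_symm_apply y) (hgψ _) (hh y)
  · exact Isometry.of_tendsto_pointwise (fun n => (f (φ (ψ n))).isometry) hgψ
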